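/- Let R : [0,b]×[0,b] → ℝ be a continuous symmetric function such that the minimization of I(ν) = ∫∫ R(s,t) ν(ds) ν(dt) over Borel probability measures on [0,b] has a unique minimizer ν*, with minimal value σ*². For k = 1, 2, …, let P_k = { b i 2^{−k} : i = 0, 1, …, 2^k } and let ν_{*,k} be a minimizer of I over probability measures supported on the finite set P_k, with value σ_{*,k}² = I(ν_{*,k}). Then σ_{*,k}² → σ*² as k → ∞, and ν_{*,k} converges weakly to ν* as k → ∞. -/

import Mathlib

open MeasureTheory Filter Set

/-- The energy functional `I(ν) = ∫∫ R(s,t) ν(ds) ν(dt)`. -/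
noncomputable def kernelEnergy (R : ℝ → ℝ → ℝ) (ν : Measure ℝ) : ℝ :=
  ∫ s, ∫ t, R s t ∂ν ∂ν

/-- The `k`-th binary partition `{ b i 2^{-k} : i = 0, …, 2^k }` of `[0,b]`. -/
def binaryPartition (b : ℝ) (k : ℕ) : Set ℝ :=
  {x | ∃ i : ℕ, i ≤ 2 ^ k ∧ x = b * i / 2 ^ k}

/-- The map rounding a point of `[0,b]` down to the `k`-th binary partition. -/
noncomputable def binaryFloor (b : ℝ) (k : ℕ) (x : ℝ) : ℝ :=
  b * ⌊x / b * 2 ^ k⌋₊ / 2 ^ k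

lemma binaryPartition_subset_Icc {b : ℝ} (hb : 0 ≤ b) (k : ℕ) :
    binaryPartition b k ⊆ Icc 0 b := by
  rintro x ⟨i, hi, rfl⟩
  have hi' : (i : ℝ) ≤ 2 ^ k := by exact_mod_cast hi
  refine ⟨by positivity, ?_⟩
  rw [div_le_iff₀ (by positivity)]
  exact mul_le_mul_of_nonneg_left hi' hb

lemma measurableSet_binaryPartition (b : ℝ) (k : ℕ) : MeasurableSet (binaryPartition b k) := by
  refine (((Set.finite_Iic (2 ^ k)).image fun i : ℕ => b * i / 2 ^ k).subset ?_).measurableSet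
  rintro x ⟨i, hi, rfl⟩
  exact ⟨i, hi, rfl⟩

lemma binaryFloor_mem {b : ℝ} (hb : 0 < b) (k : ℕ) {x : ℝ} (hx : x ∈ Icc 0 b) :
    binaryFloor b k x ∈ binaryPartition b k := by
  refine ⟨⌊x / b * 2 ^ k⌋₊, ?_, rfl⟩
  have hxb : x / b ≤ 1 := (div_le_one hb).2 hx.2
  refine Nat.floor_le_of_le ?_
  push_cast
  exact mul_le_of_le_one_left (by positivity) hxb

lemma measurable_binaryFloor (b : ℝ) (k : ℕ) : Measurable (binaryFloor b k) := by
  have h : Measurable fun x : ℝ => ⌊x / b * 2 ^ k⌋₊ :=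
    Nat.measurable_floor.comp (by fun_prop)
  have h' : Measurable fun x : ℝ => (⌊x / b * 2 ^ k⌋₊ : ℝ) := measurable_from_nat.comp h
  exact (h'.const_mul b).div_const _

lemma tendsto_binaryFloor {b : ℝ} (hb : 0 < b) {x : ℝ} (hx : 0 ≤ x) :
    Tendsto (fun k => binaryFloor b k x) atTop (nhds x) := by
  have h := ((tendsto_nat_floor_mul_div_atTop (R := ℝ) (div_nonneg hx hb.le)).comp
    (tendsto_pow_atTop_atTop_of_one_lt (one_lt_two : (1 : ℝ) < 2))).const_mul b
  rw [mul_div_cancel₀ _ hb.ne'] at h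
  simpa only [binaryFloor, Function.comp_def, mul_div_assoc] using h

/-- The energy of a measure carried by `s` depends continuously on the measure when the kernel is
continuous on the compact set `s × s`. -/
lemma continuous_kernelEnergy_map_subtype_val {s : Set ℝ} (hs : IsCompact s) {R : ℝ → ℝ → ℝ}
    (hR : ContinuousOn (fun p : ℝ × ℝ => R p.1 p.2) (s ×ˢ s)) :
    Continuous fun μ : ProbabilityMeasure s =>
      kernelEnergy R ((μ : Measure s).map Subtype.val) := by
  have : CompactSpace s := isCompact_iff_compactSpace.1 hs
  have hK : Continuous fun p : s × s => R p.1 p.2 :=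
    hR.comp_continuous (f := fun p : s × s => ((p.1 : ℝ), (p.2 : ℝ))) (by fun_prop)
      fun p => ⟨p.1.2, p.2.2⟩
  have hval := MeasurableEmbedding.subtype_coe hs.measurableSet
  have hE : ∀ μ : ProbabilityMeasure s, kernelEnergy R ((μ : Measure s).map Subtype.val) =
      ∫ p, BoundedContinuousFunction.mkOfCompact ⟨_, hK⟩ p ∂(μ.prod μ : Measure (s × s)) := by
    intro μ
    rw [ProbabilityMeasure.toMeasure_prod,
      integral_prod _ (BoundedContinuousFunction.integrable _ _)]
    simp only [kernelEnergy, hval.integral_map]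
    rfl
  simp_rw [hE]
  exact (ProbabilityMeasure.continuous_integral_boundedContinuousFunction _).comp
    (ProbabilityMeasure.continuous_prod.comp (continuous_id.prodMk continuous_id))

lemma exists_probabilityMeasure_map_subtype_val {α : Type*} [MeasurableSpace α] {s : Set α}
    (hs : MeasurableSet s) (ν : Measure α) [IsProbabilityMeasure ν] (hν : ν sᶜ = 0) :
    ∃ μ : ProbabilityMeasure s, (μ : Measure s).map Subtype.val = ν := by
  have hmap : (ν.comap (Subtype.val : s → α)).map Subtype.val = ν := by
    rw [map_comap_subtype_coe hs, Measure.restrict_eq_self_of_ae_mem]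
    exact hν
  have hp : IsProbabilityMeasure (ν.comap (Subtype.val : s → α)) := by
    constructor
    rw [← measure_univ (μ := ν), ← hmap,
      Measure.map_apply measurable_subtype_coe MeasurableSet.univ, preimage_univ, hmap]
  exact ⟨⟨_, hp⟩, hmap⟩

/-- In a compact space, if a continuous function has a unique minimizer `x₀`, then every family
along which its values tend to the minimum converges to `x₀`. -/
lemma tendsto_of_tendsto_unique_minimum {X ι : Type*} [TopologicalSpace X] [CompactSpace X]
    {E : X → ℝ} (hE : Continuous E) {x₀ : X} (huniq : ∀ x, E x = E x₀ → x = x₀)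
    {l : Filter ι} {u : ι → X} (hu : Tendsto (fun i => E (u i)) l (nhds (E x₀))) :
    Tendsto u l (nhds x₀) := by
  refine le_nhds_of_unique_clusterPt fun x hx => huniq x ?_
  have h : ClusterPt (E x) (map E (map u l)) :=
    hx.map hE.continuousAt tendsto_map
  have h' : ClusterPt (E x) (nhds (E x₀)) := h.mono hu
  exact eq_of_nhds_neBot h'

/-- Every probability measure on `[0,b]` is a weak limit of measures carried by the binary
partitions. -/
lemma exists_tendsto_binaryPartition {b : ℝ} (hb : 0 < b) (μ : ProbabilityMeasure (Icc 0 b)) :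
    ∃ u : ℕ → ProbabilityMeasure (Icc 0 b), Tendsto u atTop (nhds μ) ∧
      ∀ k, (u k : Measure (Icc 0 b)).map Subtype.val (binaryPartition b k)ᶜ = 0 := by
  have hmem : ∀ k (x : Icc 0 b), binaryFloor b k x ∈ Icc 0 b := fun k x =>
    binaryPartition_subset_Icc hb.le k (binaryFloor_mem hb k x.2)
  let φ : ℕ → Icc 0 b → Icc 0 b := fun k x => ⟨binaryFloor b k x, hmem k x⟩
  have hφ : ∀ k, Measurable (φ k) := fun k =>
    ((measurable_binaryFloor b k).comp measurable_subtype_coe).subtype_mk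
  refine ⟨fun k => μ.map (hφ k).aemeasurable, ?_, fun k => ?_⟩
  · rw [ProbabilityMeasure.tendsto_iff_forall_integral_tendsto]
    intro f
    have hmap : ∀ k, ∫ x, f x ∂(μ.map (hφ k).aemeasurable : Measure (Icc 0 b)) =
        ∫ x, f (φ k x) ∂(μ : Measure (Icc 0 b)) := fun k =>
      integral_map (hφ k).aemeasurable f.continuous.aestronglyMeasurable
    simp_rw [hmap]
    refine tendsto_integral_of_dominated_convergence (fun _ => ‖f‖)
      (fun k => (f.continuous.measurable.comp (hφ k)).aestronglyMeasurable)
      (integrable_const _) (fun k => ae_of_all _ fun x => f.norm_coe_le_norm _)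
      (ae_of_all _ fun x => ?_)
    exact (f.continuous.tendsto x).comp
      (tendsto_subtype_rng.2 (tendsto_binaryFloor hb x.2.1))
  · have hP := (measurableSet_binaryPartition b k).compl
    rw [Measure.map_apply measurable_subtype_coe hP, ProbabilityMeasure.toMeasure_map,
      Measure.map_apply (hφ k) (measurable_subtype_coe hP)]
    convert! measure_empty (μ := (μ : Measure (Icc 0 b)))
    exact eq_empty_of_forall_notMem fun x hx => hx (binaryFloor_mem hb k x.2)

/-- Let `R` be a continuous symmetric kernel on `[0,b]²` whose energy has a
unique minimizer `ν*` over probability measures on `[0,b]`, with value `σ*²`. If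
`ν_{*,k}` minimizes the energy over probability measures supported on the `k`-th binary
partition of `[0,b]`, with value `σ_{*,k}²`, then `σ_{*,k}² → σ*²` and `ν_{*,k} ⇒ ν*`
weakly as `k → ∞`. -/
theorem discretized_optimal_measures_converge
    (b : ℝ) (hb : 0 < b)
    (R : ℝ → ℝ → ℝ)
    (hRcont : ContinuousOn (fun p : ℝ × ℝ => R p.1 p.2) (Icc 0 b ×ˢ Icc 0 b))
    (hRsymm : ∀ s t, R s t = R t s)
    -- ν* is the unique minimizer over probability measures on [0,b]
    (νstar : Measure ℝ) (hprob : IsProbabilityMeasure νstar)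
    (hsupp : νstar (Icc 0 b)ᶜ = 0)
    (hopt : ∀ ν : Measure ℝ, IsProbabilityMeasure ν → ν (Icc 0 b)ᶜ = 0 →
      kernelEnergy R νstar ≤ kernelEnergy R ν)
    (huniq : ∀ ν : Measure ℝ, IsProbabilityMeasure ν → ν (Icc 0 b)ᶜ = 0 →
      (∀ ν' : Measure ℝ, IsProbabilityMeasure ν' → ν' (Icc 0 b)ᶜ = 0 →
        kernelEnergy R ν ≤ kernelEnergy R ν') → ν = νstar)
    -- ν_{*,k} minimizes the energy over probability measures on the k-th partition
    (νk : ℕ → Measure ℝ) (hkprob : ∀ k, IsProbabilityMeasure (νk k))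
    (hksupp : ∀ k, νk k (binaryPartition b k)ᶜ = 0)
    (hkopt : ∀ k, ∀ ν : Measure ℝ, IsProbabilityMeasure ν →
      ν (binaryPartition b k)ᶜ = 0 → kernelEnergy R (νk k) ≤ kernelEnergy R ν) :
    Tendsto (fun k => kernelEnergy R (νk k)) atTop (nhds (kernelEnergy R νstar)) ∧
    ∀ f : BoundedContinuousFunction ℝ ℝ,
      Tendsto (fun k => ∫ x, f x ∂(νk k)) atTop (nhds (∫ x, f x ∂νstar)) := by
  have hcont := continuous_kernelEnergy_map_subtype_val isCompact_Icc hRcont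
  have hprobMap : ∀ μ : ProbabilityMeasure (Icc 0 b),
      IsProbabilityMeasure ((μ : Measure (Icc 0 b)).map Subtype.val) := fun μ =>
    Measure.isProbabilityMeasure_map measurable_subtype_coe.aemeasurable
  have hsuppMap : ∀ μ : ProbabilityMeasure (Icc 0 b),
      (μ : Measure (Icc 0 b)).map Subtype.val (Icc 0 b)ᶜ = 0 := fun μ => by
    rw [Measure.map_apply measurable_subtype_coe measurableSet_Icc.compl]
    simp
  have hksupp' : ∀ k, νk k (Icc 0 b)ᶜ = 0 := fun k =>
    measure_mono_null (compl_subset_compl.2 (binaryPartition_subset_Icc hb.le k)) (hksupp k)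
  obtain ⟨μ, rfl⟩ := exists_probabilityMeasure_map_subtype_val measurableSet_Icc νstar hsupp
  choose μk hμk using fun k =>
    exists_probabilityMeasure_map_subtype_val measurableSet_Icc (νk k) (hksupp' k)
  obtain ⟨u, hu, hu_supp⟩ := exists_tendsto_binaryPartition hb μ
  have hval : Tendsto (fun k => kernelEnergy R (νk k)) atTop
      (nhds (kernelEnergy R ((μ : Measure (Icc 0 b)).map Subtype.val))) :=
    tendsto_of_tendsto_of_tendsto_of_le_of_le tendsto_const_nhds ((hcont.tendsto μ).comp hu)
      (fun k => hopt _ (hkprob k) (hksupp' k)) (fun k => hkopt k _ (hprobMap _) (hu_supp k))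
  refine ⟨hval, fun f => ?_⟩
  have hweak : Tendsto μk atTop (nhds μ) := by
    refine tendsto_of_tendsto_unique_minimum hcont (fun ρ hρ => ?_) (by simpa only [hμk] using hval)
    have hmap := huniq _ (hprobMap ρ) (hsuppMap ρ) fun ν' h1 h2 => hρ.trans_le (hopt ν' h1 h2)
    exact Subtype.ext ((MeasurableEmbedding.subtype_coe measurableSet_Icc).map_injective hmap)
  have h := ProbabilityMeasure.tendsto_iff_forall_integral_tendsto.1 hweak
    (f.compContinuous ⟨Subtype.val, continuous_subtype_val⟩)
  simp_rw [← hμk, (MeasurableEmbedding.subtype_coe measurableSet_Icc).integral_map]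
  exact h
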